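/- Let w be a classical solution of the full damped inextensible cantilever system with forcing p. Define E(t) = (1/2)[ ‖w_t(t)‖² + ‖u_t(t)‖² ] + (D/2)[ ‖w_xx(t)‖² + ‖(w_x w_xx)(t)‖² ]. Then for all 0 ≤ s ≤ t ≤ T: E(t) + k₂ ∫ₛᵗ ‖w_xxt(τ)‖² dτ = E(s) + ∫ₛᵗ ∫₀ᴸ p(x,τ) w_t(x,τ) dx dτ. -/

import Mathlib

open MeasureTheory Set

/-- Spatial partial derivative of a function of `(x, t)`. -/
noncomputable def pdx (f : ℝ → ℝ → ℝ) : ℝ → ℝ → ℝ := fun x t => deriv (fun y => f y t) x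

/-- Temporal partial derivative of a function of `(x, t)`. -/
noncomputable def pdt (f : ℝ → ℝ → ℝ) : ℝ → ℝ → ℝ := fun x t => deriv (fun s => f x s) t

/-- Axial displacement from the effective inextensibility constraint:
`u(x,t) = -(1/2)∫₀ˣ w_x(ξ,t)² dξ`. -/
noncomputable def uF (w : ℝ → ℝ → ℝ) : ℝ → ℝ → ℝ := fun x t =>
  -(1/2) * ∫ ξ in (0:ℝ)..x, (pdx w ξ t) ^ 2

/-- `u_t(x,t) = -∫₀ˣ w_x w_xt dξ`. -/
noncomputable def utF (w : ℝ → ℝ → ℝ) : ℝ → ℝ → ℝ := fun x t =>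
  -∫ ξ in (0:ℝ)..x, pdx w ξ t * pdt (pdx w) ξ t

/-- `u_tt(x,t) = -∫₀ˣ [w_xt² + w_x w_xtt] dξ`. -/
noncomputable def uttF (w : ℝ → ℝ → ℝ) : ℝ → ℝ → ℝ := fun x t =>
  -∫ ξ in (0:ℝ)..x, ((pdt (pdx w) ξ t) ^ 2 + pdx w ξ t * pdt (pdt (pdx w)) ξ t)

/-- A classical solution of the full damped inextensible cantilever system on
`[0,L] × [0,T]` with forcing `p`: smooth on an open neighborhood of `[0,L] × [0,T]`,
satisfying the PDE
`w_tt + D ∂ₓ⁴w + k₂ ∂ₓ⁴w_t − D ∂ₓ(w_xx² w_x) + D ∂ₓ²(w_x² w_xx) + ∂ₓ(w_x ∫ₓᴸ u_tt dξ) = p`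
pointwise and the clamped-free boundary conditions. -/
def IsFullSol (L D k2 T : ℝ) (p w : ℝ → ℝ → ℝ) : Prop :=
  (∃ U : Set (ℝ × ℝ), IsOpen U ∧ Icc (0:ℝ) L ×ˢ Icc (0:ℝ) T ⊆ U ∧
      ContDiffOn ℝ (⊤ : ℕ∞) (fun q : ℝ × ℝ => w q.1 q.2) U) ∧
  (∀ x ∈ Icc (0:ℝ) L, ∀ t ∈ Icc (0:ℝ) T,
      pdt (pdt w) x t + D * pdx (pdx (pdx (pdx w))) x t
        + k2 * pdx (pdx (pdx (pdx (pdt w)))) x t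
        - D * pdx (fun y s => (pdx (pdx w) y s) ^ 2 * pdx w y s) x t
        + D * pdx (pdx (fun y s => (pdx w y s) ^ 2 * pdx (pdx w) y s)) x t
        + pdx (fun y s => pdx w y s * ∫ ξ in y..L, uttF w ξ s) x t
      = p x t) ∧
  (∀ t ∈ Icc (0:ℝ) T,
    w 0 t = 0 ∧ pdx w 0 t = 0 ∧ pdx (pdx w) L t = 0 ∧ pdx (pdx (pdx w)) L t = 0)

/-- Joint smoothness of a function of two real variables. -/
def Sm (f : ℝ → ℝ → ℝ) : Prop := ContDiff ℝ (⊤ : ℕ∞) (fun q : ℝ × ℝ => f q.1 q.2)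

lemma Sm.differentiable {f : ℝ → ℝ → ℝ} (hf : Sm f) :
    Differentiable ℝ (fun q : ℝ × ℝ => f q.1 q.2) :=
  ContDiff.differentiable hf (by simp)

lemma Sm.cont {f : ℝ → ℝ → ℝ} (hf : Sm f) : Continuous (fun q : ℝ × ℝ => f q.1 q.2) :=
  ContDiff.continuous hf

lemma Sm.hasDerivAt_x' {f : ℝ → ℝ → ℝ} (hf : Sm f) (x t : ℝ) :
    HasDerivAt (fun y => f y t) (fderiv ℝ (fun q : ℝ × ℝ => f q.1 q.2) (x, t) (1, 0)) x := by
  have h1 : HasFDerivAt (fun q : ℝ × ℝ => f q.1 q.2) _ (x, t) := (hf.differentiable (x, t)).hasFDerivAt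
  have h2 : HasDerivAt (fun y : ℝ => (y, t)) ((1 : ℝ), (0 : ℝ)) x :=
    (hasDerivAt_id x).prodMk (hasDerivAt_const x t)
  exact h1.comp_hasDerivAt x h2

lemma Sm.hasDerivAt_t' {f : ℝ → ℝ → ℝ} (hf : Sm f) (x t : ℝ) :
    HasDerivAt (fun s => f x s) (fderiv ℝ (fun q : ℝ × ℝ => f q.1 q.2) (x, t) (0, 1)) t := by
  have h1 : HasFDerivAt (fun q : ℝ × ℝ => f q.1 q.2) _ (x, t) := (hf.differentiable (x, t)).hasFDerivAt
  have h2 : HasDerivAt (fun s : ℝ => (x, s)) ((0 : ℝ), (1 : ℝ)) t :=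
    (hasDerivAt_const t x).prodMk (hasDerivAt_id t)
  exact h1.comp_hasDerivAt t h2

lemma Sm.pdx_eq {f : ℝ → ℝ → ℝ} (hf : Sm f) (x t : ℝ) :
    pdx f x t = fderiv ℝ (fun q : ℝ × ℝ => f q.1 q.2) (x, t) (1, 0) := (hf.hasDerivAt_x' x t).deriv

lemma Sm.pdt_eq {f : ℝ → ℝ → ℝ} (hf : Sm f) (x t : ℝ) :
    pdt f x t = fderiv ℝ (fun q : ℝ × ℝ => f q.1 q.2) (x, t) (0, 1) := (hf.hasDerivAt_t' x t).deriv

lemma Sm.hx {f : ℝ → ℝ → ℝ} (hf : Sm f) (x t : ℝ) :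
    HasDerivAt (fun y => f y t) (pdx f x t) x := by
  rw [hf.pdx_eq]; exact hf.hasDerivAt_x' x t

lemma Sm.ht {f : ℝ → ℝ → ℝ} (hf : Sm f) (x t : ℝ) :
    HasDerivAt (fun s => f x s) (pdt f x t) t := by
  rw [hf.pdt_eq]; exact hf.hasDerivAt_t' x t

lemma Sm.fd {f : ℝ → ℝ → ℝ} (hf : Sm f) :
    ContDiff ℝ (⊤ : ℕ∞) (fderiv ℝ (fun q : ℝ × ℝ => f q.1 q.2)) :=
  ContDiff.fderiv_right hf (by simp)

lemma Sm.px {f : ℝ → ℝ → ℝ} (hf : Sm f) : Sm (pdx f) := by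
  have : (fun q : ℝ × ℝ => pdx f q.1 q.2) =
      fun q => fderiv ℝ (fun q : ℝ × ℝ => f q.1 q.2) q (1, 0) := by
    ext q; exact hf.pdx_eq q.1 q.2
  unfold Sm; rw [this]
  exact hf.fd.clm_apply contDiff_const

lemma Sm.pt {f : ℝ → ℝ → ℝ} (hf : Sm f) : Sm (pdt f) := by
  have : (fun q : ℝ × ℝ => pdt f q.1 q.2) =
      fun q => fderiv ℝ (fun q : ℝ × ℝ => f q.1 q.2) q (0, 1) := by
    ext q; exact hf.pdt_eq q.1 q.2
  unfold Sm; rw [this]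
  exact hf.fd.clm_apply contDiff_const

lemma Sm.comm {f : ℝ → ℝ → ℝ} (hf : Sm f) : pdt (pdx f) = pdx (pdt f) := by
  ext x t
  rw [hf.px.pdt_eq, hf.pt.pdx_eq]
  have e1 : (fun q : ℝ × ℝ => pdx f q.1 q.2) =
      fun q => fderiv ℝ (fun q : ℝ × ℝ => f q.1 q.2) q (1, 0) := by
    ext q; exact hf.pdx_eq q.1 q.2
  have e2 : (fun q : ℝ × ℝ => pdt f q.1 q.2) =
      fun q => fderiv ℝ (fun q : ℝ × ℝ => f q.1 q.2) q (0, 1) := by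
    ext q; exact hf.pdt_eq q.1 q.2
  rw [e1, e2]
  have hd : DifferentiableAt ℝ (fderiv ℝ (fun q : ℝ × ℝ => f q.1 q.2)) (x, t) :=
    (hf.fd.differentiable (by simp)) _
  have hs : IsSymmSndFDerivAt ℝ (fun q : ℝ × ℝ => f q.1 q.2) (x, t) :=
    (ContDiff.contDiffAt hf).isSymmSndFDerivAt (by
      simp only [minSmoothness_of_isRCLikeNormedField]; exact WithTop.coe_le_coe.2 (le_top : (2 : ℕ∞) ≤ ⊤))
  rw [fderiv_clm_apply hd (by fun_prop), fderiv_clm_apply hd (by fun_prop)]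
  simpa using hs (0, 1) (1, 0)

lemma Sm.mul {f g : ℝ → ℝ → ℝ} (hf : Sm f) (hg : Sm g) : Sm (fun x t => f x t * g x t) :=
  ContDiff.mul hf hg

lemma Sm.pow {f : ℝ → ℝ → ℝ} (hf : Sm f) (n : ℕ) : Sm (fun x t => f x t ^ n) :=
  ContDiff.pow hf n

/-- Differentiation under the integral sign. -/
lemma hasDerivAt_int (f f' : ℝ → ℝ → ℝ) (hf : Continuous (fun q : ℝ × ℝ => f q.1 q.2))
    (hf' : Continuous (fun q : ℝ × ℝ => f' q.1 q.2))
    (h : ∀ x t, HasDerivAt (fun s => f x s) (f' x t) t) (a b t : ℝ) :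
    HasDerivAt (fun s => ∫ x in a..b, f x s) (∫ x in a..b, f' x t) t := by
  have hK : IsCompact (uIcc a b ×ˢ Icc (t - 1) (t + 1)) := isCompact_uIcc.prod isCompact_Icc
  obtain ⟨C, hC⟩ := hK.exists_bound_of_continuousOn hf'.continuousOn
  refine (intervalIntegral.hasDerivAt_integral_of_dominated_loc_of_deriv_le
    (F := fun s x => f x s) (F' := fun s x => f' x s) (bound := fun _ => C)
    (s := Icc (t - 1) (t + 1)) (Icc_mem_nhds (by linarith) (by linarith)) ?_ ?_ ?_ ?_ ?_ ?_).2
  · refine Filter.Eventually.of_forall fun s => ?_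
    exact (hf.comp (by fun_prop : Continuous fun x : ℝ => (x, s))).aestronglyMeasurable
  · exact (hf.comp (by fun_prop : Continuous fun x : ℝ => (x, t))).intervalIntegrable _ _
  · exact (hf'.comp (by fun_prop : Continuous fun x : ℝ => (x, t))).aestronglyMeasurable
  · refine Filter.Eventually.of_forall fun x hx s hs => ?_
    exact hC (x, s) ⟨uIoc_subset_uIcc hx, hs⟩
  · exact intervalIntegrable_const
  · exact Filter.Eventually.of_forall fun x _ s _ => h x s

lemma cont_int_t (f : ℝ → ℝ → ℝ) (hf : Continuous (fun q : ℝ × ℝ => f q.1 q.2)) (a b : ℝ) :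
    Continuous (fun t => ∫ x in a..b, f x t) :=
  intervalIntegral.continuous_parametric_intervalIntegral_of_continuous'
    (f := fun t x => f x t) (by
      exact hf.comp (by fun_prop : Continuous fun q : ℝ × ℝ => (q.2, q.1))) a b

lemma cont_int_xt (f : ℝ → ℝ → ℝ) (hf : Continuous (fun q : ℝ × ℝ => f q.1 q.2)) (a : ℝ) :
    Continuous (fun q : ℝ × ℝ => ∫ x in a..q.1, f x q.2) :=
  intervalIntegral.continuous_parametric_intervalIntegral_of_continuous
    (f := fun (q : ℝ × ℝ) x => f x q.2) (by
      exact hf.comp (by fun_prop : Continuous fun q : (ℝ × ℝ) × ℝ => (q.2, q.1.2))) continuous_fst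

lemma cont_utt_integrand {w : ℝ → ℝ → ℝ} (hw : Sm w) : Continuous (fun q : ℝ × ℝ =>
    (pdt (pdx w) q.1 q.2) ^ 2 + pdx w q.1 q.2 * pdt (pdt (pdx w)) q.1 q.2) :=
  (hw.px.pt.cont.pow 2).add (hw.px.cont.mul hw.px.pt.pt.cont)

lemma cont_ut_integrand {w : ℝ → ℝ → ℝ} (hw : Sm w) : Continuous (fun q : ℝ × ℝ =>
    pdx w q.1 q.2 * pdt (pdx w) q.1 q.2) :=
  (hw.px.cont.mul hw.px.pt.cont)

lemma cont_ut {w : ℝ → ℝ → ℝ} (hw : Sm w) : Continuous (fun q : ℝ × ℝ => utF w q.1 q.2) :=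
  (cont_int_xt (fun x t => pdx w x t * pdt (pdx w) x t) (cont_ut_integrand hw) 0).neg

lemma cont_utt {w : ℝ → ℝ → ℝ} (hw : Sm w) : Continuous (fun q : ℝ × ℝ => uttF w q.1 q.2) :=
  (cont_int_xt (fun x t => (pdt (pdx w) x t) ^ 2 + pdx w x t * pdt (pdt (pdx w)) x t)
    (cont_utt_integrand hw) 0).neg

lemma ut_ht {w : ℝ → ℝ → ℝ} (hw : Sm w) (x t : ℝ) :
    HasDerivAt (fun s => utF w x s) (uttF w x t) t := by
  refine (hasDerivAt_int _ (fun x t => (pdt (pdx w) x t) ^ 2 + pdx w x t * pdt (pdt (pdx w)) x t)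
    (cont_ut_integrand hw) (cont_utt_integrand hw) ?_ 0 x t).neg
  intro x t
  exact ((hw.px.ht x t).mul (hw.px.pt.ht x t)).congr_deriv (by ring)

lemma ut_hx {w : ℝ → ℝ → ℝ} (hw : Sm w) (x t : ℝ) :
    HasDerivAt (fun y => utF w y t) (-(pdx w x t * pdt (pdx w) x t)) x := by
  have hc : Continuous fun y => pdx w y t * pdt (pdx w) y t :=
    (cont_ut_integrand hw).comp (by fun_prop : Continuous fun y : ℝ => (y, t))
  exact (intervalIntegral.integral_hasDerivAt_right (hc.intervalIntegrable _ _)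
    (hc.stronglyMeasurableAtFilter _ _) hc.continuousAt).neg

lemma G_hx {w : ℝ → ℝ → ℝ} (hw : Sm w) (L x t : ℝ) :
    HasDerivAt (fun y => ∫ ξ in y..L, uttF w ξ t) (-(uttF w x t)) x := by
  have hc : Continuous fun y => uttF w y t :=
    (cont_utt hw).comp (by fun_prop : Continuous fun y : ℝ => (y, t))
  exact (intervalIntegral.integral_hasDerivAt_left (hc.intervalIntegrable _ _)
    (hc.stronglyMeasurableAtFilter _ _) hc.continuousAt)

/-- A function vanishing on the time interval has vanishing time derivative inside. -/
lemma pdt_zero {f : ℝ → ℝ → ℝ} {x t T : ℝ} (ht : t ∈ Ioo (0:ℝ) T)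
    (h : ∀ s ∈ Icc (0:ℝ) T, f x s = 0) : pdt f x t = 0 := by
  have : (fun s => f x s) =ᶠ[nhds t] fun _ => (0:ℝ) := by
    filter_upwards [Icc_mem_nhds ht.1 ht.2] with s hs using h s hs
  unfold pdt
  rw [this.deriv_eq]; simp

/-- The power balance at a fixed time, obtained by testing the equation with `w_t`. -/
lemma balance {L D k2 T : ℝ} {p w : ℝ → ℝ → ℝ} (hL : 0 < L) (hw : Sm w)
    (hp : Continuous (fun q : ℝ × ℝ => p q.1 q.2))
    (hs : IsFullSol L D k2 T p w) {t : ℝ} (ht : t ∈ Ioo (0:ℝ) T) :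
    ∫ x in (0:ℝ)..L, (p x t * pdt w x t
      - (pdt w x t * pdt (pdt w) x t + utF w x t * uttF w x t
        + D * (pdx (pdx w) x t * pdx (pdx (pdt w)) x t
          + pdx w x t * pdx (pdx w) x t * (pdx (pdt w) x t * pdx (pdx w) x t
            + pdx w x t * pdx (pdx (pdt w)) x t)))
      - k2 * (pdx (pdx (pdt w)) x t) ^ 2) = 0 := by
  obtain ⟨-, hpde, hbc⟩ := hs
  have htI : t ∈ Icc (0:ℝ) T := Ioo_subset_Icc_self ht
  have hv := hw.pt
  have hg : Sm (fun y s => (pdx w y s) ^ 2 * pdx (pdx w) y s) := (hw.px.pow 2).mul hw.px.px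
  have hh : Sm (fun y s => (pdx (pdx w) y s) ^ 2 * pdx w y s) := (hw.px.px.pow 2).mul hw.px
  obtain ⟨b1, b2, b3, b4⟩ := hbc t htI
  have v0 : pdt w 0 t = 0 := pdt_zero ht fun s hs => (hbc s hs).1
  have vx0 : pdx (pdt w) 0 t = 0 := by
    rw [← hw.comm]; exact pdt_zero ht fun s hs => (hbc s hs).2.1
  have vxxL : pdx (pdx (pdt w)) L t = 0 := by
    rw [← hw.comm, ← hw.px.comm]; exact pdt_zero ht fun s hs => (hbc s hs).2.2.1
  have vxxxL : pdx (pdx (pdx (pdt w))) L t = 0 := by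
    rw [← hw.comm, ← hw.px.comm, ← hw.px.px.comm]
    exact pdt_zero ht fun s hs => (hbc s hs).2.2.2
  have gL : pdx (fun y s => (pdx w y s) ^ 2 * pdx (pdx w) y s) L t = 0 := by
    have := ((hw.px.hx L t).pow 2).mul (hw.px.px.hx L t)
    have h2 := this.deriv
    rw [b3, b4] at h2
    refine Eq.trans h2 ?_
    simp [b3]
  have hut0 : utF w 0 t = 0 := by simp [utF]
  set Φ : ℝ → ℝ := fun x =>
    D * (pdx (pdx (pdx w)) x t * pdt w x t - pdx (pdx w) x t * pdx (pdt w) x t)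
    + k2 * (pdx (pdx (pdx (pdt w))) x t * pdt w x t - pdx (pdx (pdt w)) x t * pdx (pdt w) x t)
    - D * ((pdx (pdx w) x t) ^ 2 * pdx w x t * pdt w x t)
    + D * (pdx (fun y s => (pdx w y s) ^ 2 * pdx (pdx w) y s) x t * pdt w x t
        - (pdx w x t) ^ 2 * pdx (pdx w) x t * pdx (pdt w) x t)
    + pdx w x t * (∫ ξ in x..L, uttF w ξ t) * pdt w x t
    + utF w x t * (∫ ξ in x..L, uttF w ξ t) with hΦ
  have hΦL : Φ L = 0 := by simp [hΦ, b3, b4, vxxL, vxxxL, gL]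
  have hΦ0 : Φ 0 = 0 := by simp [hΦ, v0, vx0, hut0]
  have hder : ∀ x ∈ Icc (0:ℝ) L, HasDerivAt Φ (p x t * pdt w x t
      - (pdt w x t * pdt (pdt w) x t + utF w x t * uttF w x t
        + D * (pdx (pdx w) x t * pdx (pdx (pdt w)) x t
          + pdx w x t * pdx (pdx w) x t * (pdx (pdt w) x t * pdx (pdx w) x t
            + pdx w x t * pdx (pdx (pdt w)) x t)))
      - k2 * (pdx (pdx (pdt w)) x t) ^ 2) x := by
    intro x hx
    have hG := G_hx hw L x t
    have hwG := (hw.px.hx x t).mul hG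
    have e := hpde x hx t htI
    have d1 : HasDerivAt Φ _ x :=
      (((((((hw.px.px.px.hx x t).mul (hv.hx x t)).sub ((hw.px.px.hx x t).mul (hv.px.hx x t))).const_mul D).add
      ((((hv.px.px.px.hx x t).mul (hv.hx x t)).sub ((hv.px.px.hx x t).mul (hv.px.hx x t))).const_mul k2)).sub
      (((hh.hx x t).mul (hv.hx x t)).const_mul D)).add
      ((((hg.px.hx x t).mul (hv.hx x t)).sub ((hg.hx x t).mul (hv.px.hx x t))).const_mul D)).add
      (hwG.mul (hv.hx x t)) |>.add ((ut_hx hw x t).mul hG)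
    refine d1.congr_deriv ?_
    have e2 : pdx (fun y s => pdx w y s * ∫ ξ in y..L, uttF w ξ s) x t = _ := hwG.deriv
    rw [← e, e2, hw.comm]
    simp only [Pi.mul_apply]
    ring
  have hcx : ∀ {f : ℝ → ℝ → ℝ}, Continuous (fun q : ℝ × ℝ => f q.1 q.2) →
      Continuous (fun x => f x t) := fun hf =>
    hf.comp (by fun_prop : Continuous fun y : ℝ => (y, t))
  have c1 := hcx hp
  have c2 := hcx hv.cont
  have c3 := hcx hv.pt.cont
  have c4 := hcx (cont_ut hw)
  have c5 := hcx (cont_utt hw)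
  have c6 := hcx hw.px.cont
  have c7 := hcx hw.px.px.cont
  have c8 := hcx hv.px.cont
  have c9 := hcx hv.px.px.cont
  rw [intervalIntegral.integral_eq_sub_of_hasDerivAt (f := Φ), hΦL, hΦ0, sub_zero]
  · intro x hx
    rw [uIcc_of_le hL.le] at hx
    exact hder x hx
  · exact Continuous.intervalIntegrable (by fun_prop) _ _

lemma energy_smooth
    (L D k2 T : ℝ) (hL : 0 < L)
    (p w : ℝ → ℝ → ℝ) (hp : Continuous (fun q : ℝ × ℝ => p q.1 q.2)) (hw : Sm w)
    (hs : IsFullSol L D k2 T p w) (s t : ℝ) (h0 : 0 ≤ s) (hst : s ≤ t) (htT : t ≤ T)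
    (E : ℝ → ℝ) (hE : E = fun τ =>
        (1/2) * ((∫ x in (0:ℝ)..L, (pdt w x τ) ^ 2)
            + (∫ x in (0:ℝ)..L, (utF w x τ) ^ 2))
          + (D/2) * ((∫ x in (0:ℝ)..L, (pdx (pdx w) x τ) ^ 2)
            + (∫ x in (0:ℝ)..L, (pdx w x τ * pdx (pdx w) x τ) ^ 2))) :
      E t + k2 * (∫ τ in s..t, ∫ x in (0:ℝ)..L, (pdt (pdx (pdx w)) x τ) ^ 2)
        = E s + ∫ τ in s..t, ∫ x in (0:ℝ)..L, p x τ * pdt w x τ := by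
  have hv := hw.pt
  have k1 := hp
  have k2' := hv.cont
  have k3 := hv.pt.cont
  have k4 := cont_ut hw
  have k5 := cont_utt hw
  have k6 := hw.px.cont
  have k7 := hw.px.px.cont
  have k8 := hv.px.cont
  have k9 := hv.px.px.cont
  have d1 := fun τ => hasDerivAt_int (fun x τ => (pdt w x τ) ^ 2)
    (fun x τ => 2 * (pdt w x τ * pdt (pdt w) x τ)) (by fun_prop) (by fun_prop)
    (fun x t => ((hv.ht x t).pow 2).congr_deriv (by push_cast; ring)) 0 L τ
  have d2 := fun τ => hasDerivAt_int (fun x τ => (utF w x τ) ^ 2)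
    (fun x τ => 2 * (utF w x τ * uttF w x τ)) (by fun_prop) (by fun_prop)
    (fun x t => ((ut_ht hw x t).pow 2).congr_deriv (by push_cast; ring)) 0 L τ
  have d3 := fun τ => hasDerivAt_int (fun x τ => (pdx (pdx w) x τ) ^ 2)
    (fun x τ => 2 * (pdx (pdx w) x τ * pdx (pdx (pdt w)) x τ)) (by fun_prop) (by fun_prop)
    (fun x t => ((hw.px.px.ht x t).pow 2).congr_deriv (by
      rw [hw.px.comm, hw.comm]; push_cast; ring)) 0 L τ
  have d4 := fun τ => hasDerivAt_int (fun x τ => (pdx w x τ * pdx (pdx w) x τ) ^ 2)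
    (fun x τ => 2 * (pdx w x τ * pdx (pdx w) x τ * (pdx (pdt w) x τ * pdx (pdx w) x τ
            + pdx w x τ * pdx (pdx (pdt w)) x τ))) (by fun_prop) (by fun_prop)
    (fun x t => (((hw.px.ht x t).mul (hw.px.px.ht x t)).pow 2).congr_deriv (by
      simp only [Pi.mul_apply]
      rw [hw.px.comm, hw.comm]; push_cast; ring)) 0 L τ
  have dE : ∀ τ, HasDerivAt E _ τ := fun τ => by
    rw [hE]
    exact (((d1 τ).add (d2 τ)).const_mul (1/2)).add (((d3 τ).add (d4 τ)).const_mul (D/2))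
  have cP : Continuous fun τ => ∫ x in (0:ℝ)..L, p x τ * pdt w x τ :=
    cont_int_t (fun x τ => p x τ * pdt w x τ) (by fun_prop) 0 L
  have cQ : Continuous fun τ => ∫ x in (0:ℝ)..L, (pdt (pdx (pdx w)) x τ) ^ 2 := by
    rw [hw.px.comm, hw.comm]
    exact cont_int_t (fun x τ => (pdx (pdx (pdt w)) x τ) ^ 2) (by fun_prop) 0 L
  have key : ∀ τ ∈ Ioo s t, HasDerivAt E ((∫ x in (0:ℝ)..L, p x τ * pdt w x τ)
      - k2 * ∫ x in (0:ℝ)..L, (pdt (pdx (pdx w)) x τ) ^ 2) τ := by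
    intro τ hτ
    refine (dE τ).congr_deriv ?_
    have hb := balance hL hw hp hs (t := τ) ⟨h0.trans_lt hτ.1, hτ.2.trans_le htT⟩
    have hcx : ∀ {f : ℝ → ℝ → ℝ}, Continuous (fun q : ℝ × ℝ => f q.1 q.2) →
        Continuous (fun x => f x τ) := fun hf =>
      hf.comp (by fun_prop : Continuous fun y : ℝ => (y, τ))
    have c1 := hcx hp
    have c2 := hcx hv.cont
    have c3 := hcx hv.pt.cont
    have c4 := hcx (cont_ut hw)
    have c5 := hcx (cont_utt hw)
    have c6 := hcx hw.px.cont
    have c7 := hcx hw.px.px.cont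
    have c8 := hcx hv.px.cont
    have c9 := hcx hv.px.px.cont
    rw [intervalIntegral.integral_sub, intervalIntegral.integral_sub, intervalIntegral.integral_add,
      intervalIntegral.integral_add, intervalIntegral.integral_const_mul,
      intervalIntegral.integral_const_mul, intervalIntegral.integral_add] at hb
    · simp only [intervalIntegral.integral_const_mul]
      rw [hw.px.comm, hw.comm]
      linarith
    all_goals exact Continuous.intervalIntegrable (by fun_prop) _ _
  have hcE : Continuous E := continuous_iff_continuousAt.2 fun τ => (dE τ).continuousAt
  have hF := intervalIntegral.integral_eq_sub_of_hasDerivAt_of_le hst hcE.continuousOn key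
    (Continuous.intervalIntegrable (by fun_prop) _ _)
  rw [intervalIntegral.integral_sub (cP.intervalIntegrable _ _)
    ((cQ.intervalIntegrable _ _).const_mul k2), intervalIntegral.integral_const_mul] at hF
  linarith

lemma eqOn_pdx {f g : ℝ → ℝ → ℝ} {I J : Set ℝ} (hI : IsOpen I)
    (h : ∀ x ∈ I, ∀ t ∈ J, f x t = g x t) : ∀ x ∈ I, ∀ t ∈ J, pdx f x t = pdx g x t := by
  intro x hx t ht
  refine Filter.EventuallyEq.deriv_eq ?_
  filter_upwards [hI.mem_nhds hx] with y hy using h y hy t ht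

lemma eqOn_pdt {f g : ℝ → ℝ → ℝ} {I J : Set ℝ} (hJ : IsOpen J)
    (h : ∀ x ∈ I, ∀ t ∈ J, f x t = g x t) : ∀ x ∈ I, ∀ t ∈ J, pdt f x t = pdt g x t := by
  intro x hx t ht
  refine Filter.EventuallyEq.deriv_eq ?_
  filter_upwards [hJ.mem_nhds ht] with y hy using h x hx y hy

lemma eqOn_int {f g : ℝ → ℝ → ℝ} {I J : Set ℝ} (hI : I.OrdConnected)
    (h : ∀ x ∈ I, ∀ t ∈ J, f x t = g x t) {a b : ℝ} (ha : a ∈ I) (hb : b ∈ I) :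
    ∀ t ∈ J, ∫ x in a..b, f x t = ∫ x in a..b, g x t := by
  intro t ht
  refine intervalIntegral.integral_congr fun x hx => ?_
  exact h x (hI.uIcc_subset ha hb hx) t ht

/-- Extension of a function smooth near the rectangle to a globally smooth one. -/
lemma exists_ext {L T : ℝ} (hL : 0 < L) (hT : 0 < T) {w : ℝ → ℝ → ℝ} {U : Set (ℝ × ℝ)}
    (hU : IsOpen U)
    (hK : Icc (0:ℝ) L ×ˢ Icc (0:ℝ) T ⊆ U)
    (hw : ContDiffOn ℝ (⊤ : ℕ∞) (fun q : ℝ × ℝ => w q.1 q.2) U) :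
    ∃ W : ℝ → ℝ → ℝ, Sm W ∧ ∃ ε > 0, ∀ x ∈ Ioo (-ε) (L + ε), ∀ t ∈ Ioo (-ε) (T + ε),
      w x t = W x t := by
  have hKc : IsCompact (Icc (0:ℝ) L ×ˢ Icc (0:ℝ) T) := isCompact_Icc.prod isCompact_Icc
  obtain ⟨χ, h0, h1, -⟩ := exists_contMDiffMap_zero_one_nhds_of_isClosed (n := (⊤ : ℕ∞))
    (modelWithCornersSelf ℝ (ℝ × ℝ)) hU.isClosed_compl hKc.isClosed
    (by rw [← subset_compl_iff_disjoint_left, compl_compl]; exact hK)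
  have hχ : ContDiff ℝ (⊤ : ℕ∞) (fun q : ℝ × ℝ => χ q) := χ.contMDiff.contDiff
  refine ⟨fun x t => χ (x, t) * w x t, ?_, ?_⟩
  · refine contDiff_iff_contDiffAt.2 fun q => ?_
    by_cases hq : q ∈ U
    · exact hχ.contDiffAt.mul (hw.contDiffAt (hU.mem_nhds hq))
    · have : (fun q : ℝ × ℝ => χ (q.1, q.2) * w q.1 q.2) =ᶠ[nhds q] fun _ => 0 := by
        filter_upwards [h0.filter_mono (nhds_le_nhdsSet hq)] with y hy
        simp [hy]
      exact contDiffAt_const.congr_of_eventuallyEq this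
  · obtain ⟨V, hVo, hKV, hV⟩ := mem_nhdsSet_iff_exists.1 h1
    obtain ⟨ε, hε, hεV⟩ := hKc.exists_thickening_subset_open hVo hKV
    refine ⟨ε, hε, fun x hx t ht => ?_⟩
    have : (x, t) ∈ Metric.thickening ε (Icc (0:ℝ) L ×ˢ Icc (0:ℝ) T) := by
      rw [Metric.mem_thickening_iff]
      have aux : ∀ M y : ℝ, 0 < M → y ∈ Ioo (-ε) (M + ε) → ∃ z ∈ Icc 0 M, dist y z < ε := by
        intro M y hM hy
        rcases lt_or_ge y 0 with h | h
        · exact ⟨0, ⟨le_rfl, hM.le⟩, by rw [Real.dist_eq, abs_lt]; constructor <;> linarith [hy.1]⟩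
        rcases lt_or_ge M y with h' | h'
        · exact ⟨M, ⟨hM.le, le_rfl⟩, by rw [Real.dist_eq, abs_lt]; constructor <;> linarith [hy.2]⟩
        · exact ⟨y, ⟨h, h'⟩, by simpa using hε⟩
      obtain ⟨a, ha, ha'⟩ := aux L x hL hx
      obtain ⟨b, hb, hb'⟩ := aux T t hT ht
      exact ⟨(a, b), ⟨ha, hb⟩, by rw [Prod.dist_eq]; exact max_lt ha' hb'⟩
    have h := hV (hεV this)
    simp only [mem_ofPred_eq] at h
    simp [h]

/-- Energy dissipation identity of Theorem 5.1 for classical solutions of the full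
damped inextensible cantilever system:
`E(t) + k₂∫ₛᵗ‖w_xxt‖² dτ = E(s) + ∫ₛᵗ∫₀ᴸ p w_t dx dτ`. -/
theorem full_energy_identity
    (L D k2 T : ℝ) (hL : 0 < L) (hD : 0 < D) (hk2 : 0 < k2) (hT : 0 < T)
    (p w : ℝ → ℝ → ℝ) (hp : ContDiff ℝ (⊤ : ℕ∞) (fun q : ℝ × ℝ => p q.1 q.2))
    (hw : IsFullSol L D k2 T p w) :
    ∀ s t : ℝ, 0 ≤ s → s ≤ t → t ≤ T →
      (let E : ℝ → ℝ := fun τ =>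
        (1/2) * ((∫ x in (0:ℝ)..L, (pdt w x τ) ^ 2)
            + (∫ x in (0:ℝ)..L, (utF w x τ) ^ 2))
          + (D/2) * ((∫ x in (0:ℝ)..L, (pdx (pdx w) x τ) ^ 2)
            + (∫ x in (0:ℝ)..L, (pdx w x τ * pdx (pdx w) x τ) ^ 2))
      E t + k2 * (∫ τ in s..t, ∫ x in (0:ℝ)..L, (pdt (pdx (pdx w)) x τ) ^ 2)
        = E s + ∫ τ in s..t, ∫ x in (0:ℝ)..L, p x τ * pdt w x τ) := by
  intro s t h0 hst htT
  obtain ⟨⟨U, hU, hK, hwU⟩, hpde, hbc⟩ := hw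
  obtain ⟨W, hW, ε, hε, e⟩ := exists_ext hL hT hU hK hwU
  have hI : IsOpen (Ioo (-ε) (L + ε)) := isOpen_Ioo
  have hJ : IsOpen (Ioo (-ε) (T + ε)) := isOpen_Ioo
  have hIo : (Ioo (-ε) (L + ε)).OrdConnected := ordConnected_Ioo
  have sI : Icc 0 L ⊆ Ioo (-ε) (L + ε) := fun x hx => ⟨by linarith [hx.1], by linarith [hx.2]⟩
  have sJ : Icc 0 T ⊆ Ioo (-ε) (T + ε) := fun x hx => ⟨by linarith [hx.1], by linarith [hx.2]⟩
  have I0 : (0:ℝ) ∈ Ioo (-ε) (L + ε) := sI ⟨le_rfl, hL.le⟩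
  have IL : L ∈ Ioo (-ε) (L + ε) := sI ⟨hL.le, le_rfl⟩
  have ex := eqOn_pdx hI e
  have exx := eqOn_pdx hI ex
  have exxx := eqOn_pdx hI exx
  have exxxx := eqOn_pdx hI exxx
  have et := eqOn_pdt hJ e
  have ett := eqOn_pdt hJ et
  have etxxxx := eqOn_pdx hI (eqOn_pdx hI (eqOn_pdx hI (eqOn_pdx hI et)))
  have ext' := eqOn_pdt hJ ex
  have extt := eqOn_pdt hJ ext'
  have exxt := eqOn_pdt hJ exx
  have eut : ∀ x ∈ Ioo (-ε) (L + ε), ∀ t ∈ Ioo (-ε) (T + ε), utF w x t = utF W x t := by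
    intro x hx t ht
    exact congrArg Neg.neg (eqOn_int (f := fun x t => pdx w x t * pdt (pdx w) x t)
      (g := fun x t => pdx W x t * pdt (pdx W) x t) hIo
      (fun x hx t ht => by simp only [ex x hx t ht, ext' x hx t ht]) I0 hx t ht)
  have eutt : ∀ x ∈ Ioo (-ε) (L + ε), ∀ t ∈ Ioo (-ε) (T + ε), uttF w x t = uttF W x t := by
    intro x hx t ht
    exact congrArg Neg.neg (eqOn_int
      (f := fun x t => (pdt (pdx w) x t) ^ 2 + pdx w x t * pdt (pdt (pdx w)) x t)
      (g := fun x t => (pdt (pdx W) x t) ^ 2 + pdx W x t * pdt (pdt (pdx W)) x t) hIo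
      (fun x hx t ht => by simp only [ex x hx t ht, ext' x hx t ht, extt x hx t ht]) I0 hx t ht)
  have e1 := eqOn_pdx (J := Ioo (-ε) (T + ε)) (f := fun y s => (pdx (pdx w) y s) ^ 2 * pdx w y s)
    (g := fun y s => (pdx (pdx W) y s) ^ 2 * pdx W y s) hI
    (fun x hx t ht => by simp only [ex x hx t ht, exx x hx t ht])
  have e2 := eqOn_pdx hI (eqOn_pdx (J := Ioo (-ε) (T + ε)) (f := fun y s => (pdx w y s) ^ 2 * pdx (pdx w) y s)
    (g := fun y s => (pdx W y s) ^ 2 * pdx (pdx W) y s) hI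
    (fun x hx t ht => by simp only [ex x hx t ht, exx x hx t ht]))
  have e3 := eqOn_pdx (J := Ioo (-ε) (T + ε)) (f := fun y s => pdx w y s * ∫ ξ in y..L, uttF w ξ s)
    (g := fun y s => pdx W y s * ∫ ξ in y..L, uttF W ξ s) hI
    (fun x hx t ht => by simp only [ex x hx t ht, eqOn_int hIo eutt hx IL t ht])
  have hsol : IsFullSol L D k2 T p W := by
    refine ⟨⟨univ, isOpen_univ, subset_univ _, ContDiff.contDiffOn hW⟩, ?_, ?_⟩
    · intro x hx t ht
      have h := hpde x hx t ht
      have hx' := sI hx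
      have ht' := sJ ht
      rw [ett x hx' t ht', exxxx x hx' t ht', etxxxx x hx' t ht', e1 x hx' t ht', e2 x hx' t ht',
        e3 x hx' t ht'] at h
      exact h
    · intro t ht
      have ht' := sJ ht
      have h := hbc t ht
      rw [e 0 I0 t ht', ex 0 I0 t ht', exx L IL t ht', exxx L IL t ht'] at h
      exact h
  have main := energy_smooth L D k2 T hL p W (ContDiff.continuous hp) hW hsol s t h0 hst htT _ rfl
  have i1 := eqOn_int (J := Ioo (-ε) (T + ε)) (f := fun x t => (pdt w x t) ^ 2) (g := fun x t => (pdt W x t) ^ 2) hIo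
    (fun x hx t ht => by simp only [et x hx t ht]) I0 IL
  have i2 := eqOn_int (J := Ioo (-ε) (T + ε)) (f := fun x t => (utF w x t) ^ 2) (g := fun x t => (utF W x t) ^ 2) hIo
    (fun x hx t ht => by simp only [eut x hx t ht]) I0 IL
  have i3 := eqOn_int (J := Ioo (-ε) (T + ε)) (f := fun x t => (pdx (pdx w) x t) ^ 2)
    (g := fun x t => (pdx (pdx W) x t) ^ 2) hIo
    (fun x hx t ht => by simp only [exx x hx t ht]) I0 IL
  have i4 := eqOn_int (J := Ioo (-ε) (T + ε)) (f := fun x t => (pdx w x t * pdx (pdx w) x t) ^ 2)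
    (g := fun x t => (pdx W x t * pdx (pdx W) x t) ^ 2) hIo
    (fun x hx t ht => by simp only [ex x hx t ht, exx x hx t ht]) I0 IL
  have i5 := eqOn_int (J := Ioo (-ε) (T + ε)) (f := fun x t => (pdt (pdx (pdx w)) x t) ^ 2)
    (g := fun x t => (pdt (pdx (pdx W)) x t) ^ 2) hIo
    (fun x hx t ht => by simp only [exxt x hx t ht]) I0 IL
  have i6 := eqOn_int (J := Ioo (-ε) (T + ε)) (f := fun x t => p x t * pdt w x t)
    (g := fun x t => p x t * pdt W x t) hIo
    (fun x hx t ht => by simp only [et x hx t ht]) I0 IL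
  have hsJ := sJ ⟨h0, hst.trans htT⟩
  have htJ := sJ ⟨h0.trans hst, htT⟩
  have hJst : ∀ τ ∈ uIcc s t, τ ∈ Ioo (-ε) (T + ε) := fun τ hτ =>
    ordConnected_Ioo.uIcc_subset hsJ htJ hτ
  have j5 : ∫ τ in s..t, ∫ x in (0:ℝ)..L, (pdt (pdx (pdx w)) x τ) ^ 2
      = ∫ τ in s..t, ∫ x in (0:ℝ)..L, (pdt (pdx (pdx W)) x τ) ^ 2 :=
    intervalIntegral.integral_congr fun τ hτ => i5 τ (hJst τ hτ)
  have j6 : ∫ τ in s..t, ∫ x in (0:ℝ)..L, p x τ * pdt w x τ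
      = ∫ τ in s..t, ∫ x in (0:ℝ)..L, p x τ * pdt W x τ :=
    intervalIntegral.integral_congr fun τ hτ => i6 τ (hJst τ hτ)
  simp only [] at main i1 i2 i3 i4 ⊢
  rw [i1 t htJ, i2 t htJ, i3 t htJ, i4 t htJ, i1 s hsJ, i2 s hsJ, i3 s hsJ, i4 s hsJ, j5, j6]
  exact main
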